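/- If T is a densely defined closed normal right linear operator in a quaternionic Hilbert space, then there exists a unitary operator W with T = W|T|. -/

import Mathlib

noncomputable section

open MulOpposite

local notation "ℍ" => Quaternion ℝ

variable {H : Type*} [NormedAddCommGroup H] [Module ℍᵐᵒᵖ H]

/-- The axioms of a quaternion-valued inner product compatible with the norm on a
right quaternionic module `H` (scalars act on the right via `ℍᵐᵒᵖ`). -/
structure QInner (inn : H → H → ℍ) : Prop where
  add_right : ∀ u v w : H, inn u (v + w) = inn u v + inn u w
  smul_right : ∀ (u v : H) (q : ℍ), inn u (op q • v) = inn u v * q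
  conj_symm : ∀ u v : H, inn u v = star (inn v u)
  norm_sq : ∀ u : H, inn u u = ((‖u‖ ^ 2 : ℝ) : ℍ)

/-- `B` is the adjoint of the bounded right linear operator `A`. -/
def IsAdjB (inn : H → H → ℍ) (A B : H →L[ℍᵐᵒᵖ] H) : Prop :=
  ∀ x y : H, inn (B x) y = inn x (A y)

/-- `A` is a positive bounded operator. -/
def IsPosB (inn : H → H → ℍ) (A : H →L[ℍᵐᵒᵖ] H) : Prop :=
  IsAdjB inn A A ∧ ∀ x : H, ∃ r : ℝ, 0 ≤ r ∧ inn x (A x) = (r : ℍ)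

/-- Orthogonal complement of a set. -/
def qOrth (inn : H → H → ℍ) (S : Set H) : Set H := {x | ∀ y ∈ S, inn y x = 0}

/-- Null space of a bounded operator. -/
def kerB (A : H →L[ℍᵐᵒᵖ] H) : Set H := {x | A x = 0}

/-- `U` is a partial isometry: it is isometric on `N(U)^⊥`. -/
def IsPartialIsomB (inn : H → H → ℍ) (U : H →L[ℍᵐᵒᵖ] H) : Prop :=
  ∀ x ∈ qOrth inn (kerB U), ‖U x‖ = ‖x‖

/-- Null space of an unbounded operator. -/
def pKer (T : H →ₗ.[ℍᵐᵒᵖ] H) : Set H := {x | ∃ hx : x ∈ T.domain, T ⟨x, hx⟩ = 0}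

/-- Range of an unbounded operator. -/
def pRan (T : H →ₗ.[ℍᵐᵒᵖ] H) : Set H := Set.range fun x : T.domain => T x

/-- `S` is the adjoint of the densely defined operator `T` : the formal adjoint
identity holds and the domain of `S` is maximal. -/
def IsAdjP (inn : H → H → ℍ) (T S : H →ₗ.[ℍᵐᵒᵖ] H) : Prop :=
  (∀ (x : S.domain) (y : T.domain), inn (x : H) (T y) = inn (S x) (y : H)) ∧
  ∀ x z : H, (∀ y : T.domain, inn x (T y) = inn z (y : H)) → x ∈ S.domain

/-- `T` is a positive (self-adjoint) unbounded operator. -/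
def IsPosP (inn : H → H → ℍ) (T : H →ₗ.[ℍᵐᵒᵖ] H) : Prop :=
  IsAdjP inn T T ∧ ∀ x : T.domain, ∃ r : ℝ, 0 ≤ r ∧ inn (x : H) (T x) = (r : ℍ)

/-- `C = S ∘ T` as unbounded operators, with the usual maximal domain. -/
def IsCompP (S T C : H →ₗ.[ℍᵐᵒᵖ] H) : Prop :=
  (∀ x : H, x ∈ C.domain ↔ ∃ hx : x ∈ T.domain, T ⟨x, hx⟩ ∈ S.domain) ∧
  ∀ (x : C.domain) (hx : (x : H) ∈ T.domain) (h2 : T ⟨x, hx⟩ ∈ S.domain),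
    C x = S ⟨T ⟨x, hx⟩, h2⟩

/-- `T = U ∘ P` where `U` is bounded and `T`, `P` are unbounded. -/
def EqCompB (T : H →ₗ.[ℍᵐᵒᵖ] H) (U : H →L[ℍᵐᵒᵖ] H) (P : H →ₗ.[ℍᵐᵒᵖ] H) : Prop :=
  T.domain = P.domain ∧
  ∀ (x : H) (hx : x ∈ T.domain) (hx' : x ∈ P.domain), T ⟨x, hx⟩ = U (P ⟨x, hx'⟩)

/-- The bounded operator `B` commutes with the unbounded operator `T`, i.e. `TB ⊆ BT`. -/
def CommP (B : H →L[ℍᵐᵒᵖ] H) (T : H →ₗ.[ℍᵐᵒᵖ] H) : Prop :=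
  ∀ x : T.domain, ∃ h : B (x : H) ∈ T.domain, T ⟨B (x : H), h⟩ = B (T x)


section Helpers

variable {K : Type*} [NormedAddCommGroup K] [Module ℍᵐᵒᵖ K]

namespace QInner

variable {inn : K → K → ℍ}

theorem zero_right (h : QInner inn) (u : K) : inn u 0 = 0 := by
  have := h.add_right u 0 0
  simpa using this

theorem zero_left (h : QInner inn) (u : K) : inn 0 u = 0 := by
  rw [h.conj_symm, h.zero_right, star_zero]

theorem neg_right (h : QInner inn) (u v : K) : inn u (-v) = - inn u v := by
  have := h.add_right u v (-v)
  rw [add_neg_cancel, h.zero_right] at this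
  exact (neg_eq_of_add_eq_zero_right this.symm).symm

theorem sub_right (h : QInner inn) (u v w : K) : inn u (v - w) = inn u v - inn u w := by
  rw [sub_eq_add_neg, h.add_right, h.neg_right, sub_eq_add_neg]

theorem add_left (h : QInner inn) (u v w : K) : inn (u + v) w = inn u w + inn v w := by
  rw [h.conj_symm, h.add_right, star_add, ← h.conj_symm, ← h.conj_symm]

theorem sub_left (h : QInner inn) (u v w : K) : inn (u - v) w = inn u w - inn v w := by
  rw [h.conj_symm, h.sub_right, star_sub, ← h.conj_symm, ← h.conj_symm]

theorem eq_zero_symm (h : QInner inn) {u v : K} (huv : inn u v = 0) : inn v u = 0 := by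
  rw [h.conj_symm, huv, star_zero]

theorem eq_zero_of_self (h : QInner inn) {u : K} (hu : inn u u = 0) : u = 0 := by
  rw [h.norm_sq] at hu
  have h2 : (‖u‖ ^ 2 : ℝ) = 0 := by
    have := congrArg QuaternionAlgebra.re hu
    rwa [Quaternion.re_coe] at this
  simpa using h2

theorem norm_sq_re (h : QInner inn) (u : K) : ‖u‖ ^ 2 = (inn u u).re := by
  rw [h.norm_sq, Quaternion.re_coe]

theorem re_symm (h : QInner inn) (u v : K) : (inn u v).re = (inn v u).re := by
  rw [h.conj_symm, Quaternion.re_star]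

theorem norm_add_sq (h : QInner inn) (u v : K) :
    ‖u + v‖ ^ 2 = ‖u‖ ^ 2 + 2 * (inn u v).re + ‖v‖ ^ 2 := by
  simp only [h.norm_sq_re, h.add_left, h.add_right, Quaternion.re_add]
  rw [h.re_symm v u]; ring

theorem smul_left (h : QInner inn) (u v : K) (q : ℍ) : inn (op q • u) v = star q * inn u v := by
  rw [h.conj_symm, h.smul_right, star_mul, ← h.conj_symm]

theorem norm_smul (h : QInner inn) (q : ℍ) (u : K) : ‖op q • u‖ = ‖q‖ * ‖u‖ := by
  have h1 : ‖op q • u‖ ^ 2 = (‖q‖ * ‖u‖) ^ 2 := by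
    rw [h.norm_sq_re, h.smul_right, h.smul_left, h.norm_sq, mul_assoc,
      Quaternion.coe_mul_eq_smul, mul_smul_comm, Quaternion.star_mul_self]
    rw [Quaternion.normSq_eq_norm_mul_self, ← Quaternion.coe_mul_eq_smul, ← Quaternion.coe_mul,
      Quaternion.re_coe]
    ring
  exact (sq_eq_sq₀ (by positivity) (by positivity)).1 h1

theorem continuousConstSMul (h : QInner inn) : ContinuousConstSMul ℍᵐᵒᵖ K where
  continuous_const_smul q := by
    refine continuous_iff_continuousAt.2 fun x => ?_
    rw [Metric.continuousAt_iff]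
    intro ε hε
    refine ⟨ε / (‖unop q‖ + 1), by positivity, fun {y} hy => ?_⟩
    rw [dist_eq_norm] at hy ⊢
    rw [← smul_sub, ← op_unop q, h.norm_smul]
    rw [lt_div_iff₀ (by positivity)] at hy
    nlinarith [norm_nonneg (y - x), norm_nonneg (unop q)]

/-- vanishing of all real parts gives vanishing -/
theorem eq_zero_of_re (q : ℍ) (hq : ∀ p : ℍ, (q * p).re = 0) : q = 0 := by
  have := hq (star q)
  rw [Quaternion.self_mul_star, Quaternion.re_coe] at this
  exact Quaternion.normSq_eq_zero.1 this

/-- the real inner product space underlying a quaternionic one -/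
@[reducible] def realInner (h : QInner inn) : InnerProductSpace ℝ K :=
  letI : Module ℝ K := Module.compHom K (algebraMap ℝ ℍᵐᵒᵖ)
  have hs : ∀ (r : ℝ) (x : K), r • x = op (r : ℍ) • x := fun r x => rfl
  { norm_smul_le := fun r x => by
      rw [hs, h.norm_smul, Quaternion.norm_coe]
    inner := fun x y => (inn x y).re
    norm_sq_eq_re_inner := fun x => by
      rw [h.norm_sq_re]; rfl
    conj_inner_symm := fun x y => h.re_symm y x
    add_left := fun x y z => by
      simp [h.add_left]
    smul_left := fun x y r => by
      rw [hs, h.smul_left, Quaternion.star_coe, Quaternion.coe_mul_eq_smul]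
      simp }

theorem exists_proj [CompleteSpace K] (h : QInner inn) (G : Submodule ℍᵐᵒᵖ K)
    (hG : IsClosed (G : Set K)) (x : K) : ∃ p ∈ G, ∀ g ∈ G, inn g (x - p) = 0 := by
  let _ := h.realInner
  let G' : Submodule ℝ K :=
    { carrier := G
      add_mem' := fun ha hb => G.add_mem ha hb
      zero_mem' := G.zero_mem
      smul_mem' := fun r y hy => G.smul_mem (op (r : ℍ)) hy }
  obtain ⟨p, hp, hmin⟩ := Submodule.exists_norm_eq_iInf_of_complete_subspace G'
    (hG.isComplete : IsComplete (G : Set K)) x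
  rw [Submodule.norm_eq_iInf_iff_real_inner_eq_zero G' hp] at hmin
  refine ⟨p, hp, fun g hg => h.eq_zero_symm (eq_zero_of_re _ fun q => ?_)⟩
  rw [← h.smul_right]
  exact hmin _ (G.smul_mem (op q) hg)

theorem dense_of_orth [CompleteSpace K] (h : QInner inn) (G : Submodule ℍᵐᵒᵖ K)
    (hG : ∀ z, (∀ g ∈ G, inn z g = 0) → z = 0) : Dense (G : Set K) := by
  have := h.continuousConstSMul
  intro x
  obtain ⟨p, hp, hpo⟩ := h.exists_proj G.topologicalClosure G.isClosed_topologicalClosure x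
  have : x - p = 0 := hG _ fun g hg =>
    h.eq_zero_symm (hpo g (G.le_topologicalClosure hg))
  rw [sub_eq_zero.1 this]
  exact hp

/-- inner product on the square -/
theorem prod (h : QInner inn) :
    QInner (fun x y : WithLp 2 (K × K) => inn x.fst y.fst + inn x.snd y.snd) where
  add_right u v w := by
    simp only [WithLp.add_fst, WithLp.add_snd, h.add_right]; abel
  smul_right u v q := by
    simp only [WithLp.smul_fst, WithLp.smul_snd, h.smul_right, add_mul]
  conj_symm u v := by
    rw [star_add, ← h.conj_symm, ← h.conj_symm]
  norm_sq u := by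
    rw [h.norm_sq, h.norm_sq, WithLp.prod_norm_sq_eq_of_L2]; push_cast; rfl

theorem exists_proj₂ [CompleteSpace K] (h : QInner inn) (G : Submodule ℍᵐᵒᵖ (K × K))
    (hG : IsClosed (G : Set (K × K))) (u v : K) :
    ∃ p q : K, (p, q) ∈ G ∧ ∀ a b, (a, b) ∈ G → inn a (u - p) + inn b (v - q) = 0 := by
  let G' : Submodule ℍᵐᵒᵖ (WithLp 2 (K × K)) :=
    G.comap (WithLp.linearEquiv 2 ℍᵐᵒᵖ (K × K)).toLinearMap
  have hG' : IsClosed (G' : Set (WithLp 2 (K × K))) :=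
    hG.preimage (WithLp.prod_continuous_ofLp 2 K K)
  obtain ⟨p, hp, hpo⟩ := h.prod.exists_proj G' hG' (WithLp.toLp 2 (u, v))
  refine ⟨p.fst, p.snd, hp, fun a b hab => ?_⟩
  exact hpo (WithLp.toLp 2 (a, b)) hab

/-- the unit i -/
def qi : ℍ := ⟨0, 1, 0, 0⟩

/-- the unit j -/
def qj : ℍ := ⟨0, 0, 1, 0⟩

/-- the unit k -/
def qk : ℍ := ⟨0, 0, 0, 1⟩

theorem qi_re : qi.re = 0 := rfl

theorem qi_imI : qi.imI = 1 := rfl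

theorem qi_imJ : qi.imJ = 0 := rfl

theorem qi_imK : qi.imK = 0 := rfl

theorem qj_re : qj.re = 0 := rfl

theorem qj_imI : qj.imI = 0 := rfl

theorem qj_imJ : qj.imJ = 1 := rfl

theorem qj_imK : qj.imK = 0 := rfl

theorem qk_re : qk.re = 0 := rfl

theorem qk_imI : qk.imI = 0 := rfl

theorem qk_imJ : qk.imJ = 0 := rfl

theorem qk_imK : qk.imK = 1 := rfl

theorem continuous_right (h : QInner inn) (u : K) : Continuous (inn u) := by
  have := h.continuousConstSMul
  -- the real part is continuous by polarization, the rest follows by multiplication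
  have hre : ∀ u : K, Continuous fun v => (inn u v).re := by
    intro u
    have : (fun v => (inn u v).re) = fun v => (‖u + v‖ ^ 2 - ‖u‖ ^ 2 - ‖v‖ ^ 2) / 2 := by
      funext v; rw [h.norm_add_sq]; ring
    rw [this]; fun_prop
  have hq : ∀ q : ℍ, Continuous fun v => (inn u v * q).re := by
    intro q
    simp only [← h.smul_right]
    exact (hre u).comp (continuous_const_smul (op q))
  have e : inn u = fun v => ((inn u v * 1).re : ℍ)
      + ((inn u v * (-qi)).re : ℍ) * qi
      + ((inn u v * (-qj)).re : ℍ) * qj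
      + ((inn u v * (-qk)).re : ℍ) * qk := by
    funext v
    simp only [Quaternion.coe_mul_eq_smul]
    ext <;> simp [-Quaternion.coe_mul, -Quaternion.coe_sub, qi_re, qi_imI, qi_imJ, qi_imK, qj_re, qj_imI,
      qj_imJ, qj_imK, qk_re, qk_imI, qk_imJ, qk_imK]
  rw [e]
  refine ((Continuous.add ?_ ?_).add ?_).add ?_
  · exact Quaternion.continuous_coe.comp (hq 1)
  all_goals exact (Quaternion.continuous_coe.comp (hq _)).mul continuous_const

end QInner

open Filter Topology in
theorem exists_lim_of_norm_eq [CompleteSpace K] {L : Type*} [NormedAddCommGroup L]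
    {a : ℕ → L} {b : ℕ → K} {l : L} (ha : Tendsto a atTop (𝓝 l))
    (hab : ∀ n m, ‖a n - a m‖ = ‖b n - b m‖) : ∃ y, Tendsto b atTop (𝓝 y) := by
  apply cauchySeq_tendsto_of_complete
  have hc := ha.cauchySeq
  rw [Metric.cauchySeq_iff] at hc ⊢
  simpa only [dist_eq_norm, hab] using hc

open Filter Topology in
/-- A densely defined isometric relation extends to an everywhere defined isometry. -/
theorem exists_isometry [CompleteSpace K] {inn : K → K → ℍ} (h : QInner inn)
    (G : Submodule ℍᵐᵒᵖ (K × K)) (hn : ∀ a b, (a, b) ∈ G → ‖a‖ = ‖b‖)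
    (hd : ∀ z, (∀ a b, (a, b) ∈ G → inn z a = 0) → z = 0) :
    ∃ W : K →L[ℍᵐᵒᵖ] K, (∀ x, ‖W x‖ = ‖x‖) ∧ ∀ x, (x, W x) ∈ closure (G : Set (K × K)) := by
  have := h.continuousConstSMul
  have hn' : ∀ a b, (a, b) ∈ G.topologicalClosure → ‖b‖ = ‖a‖ := by
    intro a b hab
    have hcl : IsClosed {p : K × K | ‖p.2‖ = ‖p.1‖} :=
      isClosed_eq (by fun_prop) (by fun_prop)
    exact closure_minimal (fun p hp => (hn p.1 p.2 hp).symm) hcl hab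
  have hdense := h.dense_of_orth (G.map (LinearMap.fst ℍᵐᵒᵖ K K)) (fun z hz => hd z
    fun a b hab => hz a ⟨(a, b), hab, rfl⟩)
  have hex : ∀ x, ∃ y, (x, y) ∈ G.topologicalClosure := by
    intro x
    obtain ⟨a, ha, hax⟩ := mem_closure_iff_seq_limit.1 (hdense x)
    have : ∀ n, ∃ b, (a n, b) ∈ G := fun n => by
      obtain ⟨⟨p, q⟩, hp, hp'⟩ := ha n
      exact ⟨q, by rw [← hp']; exact hp⟩
    choose b hb using this
    obtain ⟨y, hy⟩ := exists_lim_of_norm_eq (b := b) hax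
      (fun n m => hn _ _ (G.sub_mem (hb n) (hb m)))
    exact ⟨y, mem_closure_of_tendsto (hax.prodMk_nhds hy) (Eventually.of_forall hb)⟩
  choose f hf using hex
  have huniq : ∀ x y, (x, y) ∈ G.topologicalClosure → y = f x := by
    intro x y hxy
    have h1 := hn' _ _ (G.topologicalClosure.sub_mem hxy (hf x))
    rw [sub_self, norm_zero] at h1
    exact sub_eq_zero.1 (norm_eq_zero.1 h1)
  let W : K →ₗ[ℍᵐᵒᵖ] K :=
    { toFun := f
      map_add' := fun x y => (huniq _ _ (G.topologicalClosure.add_mem (hf x) (hf y))).symm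
      map_smul' := fun q x => (huniq _ _ (G.topologicalClosure.smul_mem q (hf x))).symm }
  have hW : ∀ x, ‖W x‖ = ‖x‖ := fun x => hn' _ _ (hf x)
  exact ⟨⟨W, (AddMonoidHomClass.isometry_of_norm W hW).continuous⟩, hW, hf⟩

open Filter Topology in
theorem exists_unitary [CompleteSpace K] {inn : K → K → ℍ} (h : QInner inn)
    (G : Submodule ℍᵐᵒᵖ (K × K)) (hn : ∀ a b, (a, b) ∈ G → ‖a‖ = ‖b‖)
    (hd : ∀ z, (∀ a b, (a, b) ∈ G → inn z a = 0) → z = 0)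
    (hd' : ∀ z, (∀ a b, (a, b) ∈ G → inn z b = 0) → z = 0) :
    ∃ W Ws : K →L[ℍᵐᵒᵖ] K, IsAdjB inn W Ws ∧ Ws.comp W = 1 ∧ W.comp Ws = 1 ∧
      ∀ a b, (a, b) ∈ G → W a = b := by
  obtain ⟨W, hW, hWG⟩ := exists_isometry h G hn hd
  obtain ⟨V, hV, hVG⟩ := exists_isometry h
    (G.comap (LinearEquiv.prodComm ℍᵐᵒᵖ K K).toLinearMap) (fun a b hab => (hn b a hab).symm)
    (fun z hz => hd' z fun a b hab => hz b a hab)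
  have hWa : ∀ a b, (a, b) ∈ closure (G : Set (K × K)) → W a = b := by
    intro a b hab
    have hcl : IsClosed {p : K × K | ‖p.1‖ = ‖p.2‖} :=
      isClosed_eq (by fun_prop) (by fun_prop)
    have := h.continuousConstSMul
    have hmem : (a, W a) - (a, b) ∈ G.topologicalClosure :=
      G.topologicalClosure.sub_mem (hWG a) hab
    have : ‖a - a‖ = ‖W a - b‖ :=
      closure_minimal (fun p hp => hn p.1 p.2 hp) hcl hmem
    rw [sub_self, norm_zero] at this
    exact sub_eq_zero.1 (norm_eq_zero.1 this.symm)
  have hWV : ∀ x, W (V x) = x := by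
    intro x
    refine hWa _ _ ?_
    have := hVG x
    exact (map_mem_closure continuous_swap this (fun p hp => hp) :
      Prod.swap (x, V x) ∈ closure (G : Set (K × K)))
  have hinj : Function.Injective W := (AddMonoidHomClass.isometry_of_norm W hW).injective
  have hVW : ∀ x, V (W x) = x := fun x => hinj (hWV _)
  have hre : ∀ x y, (inn (W x) (W y)).re = (inn x y).re := by
    intro x y
    have h1 := h.norm_add_sq (W x) (W y)
    rw [← map_add, hW, hW, hW, h.norm_add_sq] at h1
    linarith
  have hpres : ∀ x y, inn (W x) (W y) = inn x y := by
    intro x y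
    refine sub_eq_zero.1 (QInner.eq_zero_of_re _ fun q => ?_)
    rw [sub_mul, ← h.smul_right, ← h.smul_right, ← map_smul, Quaternion.re_sub, hre, sub_self]
  refine ⟨W, V, fun x y => ?_, ?_, ?_, fun a b hab => hWa a b (subset_closure hab)⟩
  · rw [← hpres, hWV]
  · ext x; exact hVW x
  · ext x; exact hWV x

open Filter Topology in
/-- Two closed operators agreeing in norm on a core of the first one. -/
theorem core_compare [CompleteSpace K] {inn : K → K → ℍ} (h : QInner inn)
    (A B C : Submodule ℍᵐᵒᵖ (K × K)) (hA : IsClosed (A : Set (K × K)))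
    (hB : IsClosed (B : Set (K × K)))
    (hAf : ∀ a, (0, a) ∈ A → a = 0) (hBf : ∀ b, (0, b) ∈ B → b = 0)
    (hsurj : ∀ u, ∃ y z, (y, z) ∈ C ∧ y + z = u)
    (hAC : ∀ y z, (y, z) ∈ C → ∃ a, (y, a) ∈ A ∧ inn a a = inn y z ∧
      ∀ x w, (x, w) ∈ A → inn w a = inn x z)
    (hBC : ∀ y z, (y, z) ∈ C → ∃ b, (y, b) ∈ B ∧ inn b b = inn y z) :
    ∀ x a, (x, a) ∈ A → ∃ b, (x, b) ∈ B ∧ ‖b‖ = ‖a‖ := by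
  have := h.continuousConstSMul
  intro x a hxa
  let A₀ : Submodule ℍᵐᵒᵖ (K × K) :=
    A ⊓ (C.map (LinearMap.fst ℍᵐᵒᵖ K K)).comap (LinearMap.fst ℍᵐᵒᵖ K K)
  have hA₀ : ∀ y a, (y, a) ∈ A₀ → ∃ b, (y, b) ∈ B ∧ ‖b‖ = ‖a‖ := by
    rintro y a ⟨hya, ⟨⟨y', z⟩, hyz, rfl⟩⟩
    obtain ⟨a', ha', haa, -⟩ := hAC y' z hyz
    obtain ⟨b, hb, hbb⟩ := hBC y' z hyz
    have : a = a' := by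
      have := A.sub_mem hya ha'
      rw [Prod.mk_sub_mk] at this
      exact sub_eq_zero.1 (hAf _ (by simpa using this))
    refine ⟨b, hb, ?_⟩
    have h2 : ‖b‖ ^ 2 = ‖a‖ ^ 2 := by
      rw [h.norm_sq_re, h.norm_sq_re, hbb, this, haa]
    exact (sq_eq_sq₀ (norm_nonneg _) (norm_nonneg _)).1 h2
  have hle : A₀.topologicalClosure ≤ A :=
    A₀.topologicalClosure_minimal inf_le_left hA
  obtain ⟨p, q, hpq, hpo⟩ := h.exists_proj₂ A₀.topologicalClosure
    A₀.isClosed_topologicalClosure x a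
  have hmem : (x - p, a - q) ∈ A := A.sub_mem hxa (hle hpq)
  have hx : x - p = 0 := by
    obtain ⟨y, z, hyz, hsum⟩ := hsurj (x - p)
    obtain ⟨a', ha', -, haw⟩ := hAC y z hyz
    have h1 := hpo y a' (A₀.le_topologicalClosure ⟨ha', ⟨(y, z), hyz, rfl⟩⟩)
    rw [h.conj_symm a', haw _ _ hmem, ← h.conj_symm, ← h.add_left, hsum] at h1
    exact h.eq_zero_of_self h1
  have ha : a - q = 0 := hAf _ (by rw [← hx]; exact hmem)
  have hcl : (x, a) ∈ closure (A₀ : Set (K × K)) := by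
    rw [sub_eq_zero.1 hx, sub_eq_zero.1 ha]; exact hpq
  obtain ⟨s, hs, hsl⟩ := mem_closure_iff_seq_limit.1 hcl
  have hs1 : Tendsto (fun n => (s n).1) atTop (𝓝 x) := (continuous_fst.tendsto _).comp hsl
  have hs2 : Tendsto (fun n => (s n).2) atTop (𝓝 a) := (continuous_snd.tendsto _).comp hsl
  choose b hb hbn using fun n => hA₀ (s n).1 (s n).2 (hs n)
  obtain ⟨y, hy⟩ := exists_lim_of_norm_eq (b := b) hs2 (fun n m => by
    obtain ⟨b', hb', hbn'⟩ := hA₀ _ _ (A₀.sub_mem (hs n) (hs m))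
    have h3 := B.sub_mem (B.sub_mem (hb n) (hb m)) hb'
    have h4 : b n - b m = b' := by
      refine sub_eq_zero.1 (hBf _ ?_)
      convert h3 using 1
      ext <;> simp
    rw [h4, hbn'])
  refine ⟨y, ?_, ?_⟩
  · exact hB.mem_of_tendsto (hs1.prodMk_nhds hy) (Eventually.of_forall hb)
  · have h5 := hy.norm
    simp only [hbn] at h5
    exact tendsto_nhds_unique h5 hs2.norm

/-- the relational form of the theorem -/
theorem polar_rel [CompleteSpace K] {inn : K → K → ℍ} (h : QInner inn)
    (T S C M : Submodule ℍᵐᵒᵖ (K × K)) (hT : IsClosed (T : Set (K × K)))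
    (hTd : ∀ z, (∀ y w, (y, w) ∈ T → inn z y = 0) → z = 0)
    (hTf : ∀ a, (0, a) ∈ T → a = 0) (hSf : ∀ a, (0, a) ∈ S → a = 0)
    (hMf : ∀ a, (0, a) ∈ M → a = 0)
    (hS : ∀ x z, (x, z) ∈ S → ∀ y w, (y, w) ∈ T → inn x w = inn z y)
    (hS' : ∀ x z, (∀ y w, (y, w) ∈ T → inn x w = inn z y) → ∃ z', (x, z') ∈ S)
    (hM : ∀ x z, (x, z) ∈ M → ∀ y w, (y, w) ∈ M → inn x w = inn z y)
    (hM' : ∀ x z, (∀ y w, (y, w) ∈ M → inn x w = inn z y) → ∃ z', (x, z') ∈ M)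
    (hC1 : ∀ x z, (x, z) ∈ C ↔ ∃ w, (x, w) ∈ T ∧ (w, z) ∈ S)
    (hC2 : ∀ x z, (x, z) ∈ C ↔ ∃ w, (x, w) ∈ S ∧ (w, z) ∈ T)
    (hC3 : ∀ x z, (x, z) ∈ C ↔ ∃ w, (x, w) ∈ M ∧ (w, z) ∈ M) :
    ∃ W Ws : K →L[ℍᵐᵒᵖ] K, IsAdjB inn W Ws ∧ Ws.comp W = 1 ∧ W.comp Ws = 1 ∧
      (∀ x, (∃ t, (x, t) ∈ T) ↔ ∃ m, (x, m) ∈ M) ∧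
      ∀ x t m, (x, t) ∈ T → (x, m) ∈ M → W m = t := by
  -- full characterization of the adjoint
  have hSc : ∀ x z, (∀ y w, (y, w) ∈ T → inn x w = inn z y) → (x, z) ∈ S := by
    intro x z hxz
    obtain ⟨z', hz'⟩ := hS' x z hxz
    have : z - z' = 0 := hTd _ fun y w hyw => by
      rw [h.sub_left, ← hxz y w hyw, ← hS x z' hz' y w hyw, sub_self]
    rwa [sub_eq_zero.1 this]
  -- von Neumann
  have hsurj : ∀ u, ∃ y z, (y, z) ∈ C ∧ y + z = u := by
    intro u
    obtain ⟨p, q, hpq, hpo⟩ := h.exists_proj₂ T hT u 0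
    refine ⟨p, u - p, (hC1 _ _).2 ⟨q, hpq, hSc _ _ fun y w hyw => ?_⟩, by abel⟩
    have h1 := hpo y w hyw
    rw [zero_sub, h.neg_right, ← sub_eq_add_neg, sub_eq_zero] at h1
    rw [h.conj_symm, ← h1, ← h.conj_symm]
  have hMd : ∀ z, (∀ y w, (y, w) ∈ M → inn z y = 0) → z = 0 := by
    intro z hz
    obtain ⟨y, c, hyc, rfl⟩ := hsurj z
    obtain ⟨m, hym, hmc⟩ := (hC3 _ _).1 hyc
    have h1 := hz y m hym
    have h2 : inn c y = inn m m := (hM m c hmc y m hym).symm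
    rw [h.add_left, h2, h.norm_sq, h.norm_sq, ← Quaternion.coe_add] at h1
    have h3 : ‖y‖ ^ 2 + ‖m‖ ^ 2 = 0 := by
      have := congrArg QuaternionAlgebra.re h1
      rwa [Quaternion.re_coe] at this
    have hy : y = 0 := norm_eq_zero.1 (by nlinarith [sq_nonneg ‖y‖, sq_nonneg ‖m‖])
    have hm : m = 0 := norm_eq_zero.1 (by nlinarith [sq_nonneg ‖y‖, sq_nonneg ‖m‖])
    subst hm
    rw [hy, hMf c hmc, add_zero]
  have hMc : ∀ x z, (∀ y w, (y, w) ∈ M → inn x w = inn z y) → (x, z) ∈ M := by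
    intro x z hxz
    obtain ⟨z', hz'⟩ := hM' x z hxz
    have : z - z' = 0 := hMd _ fun y w hyw => by
      rw [h.sub_left, ← hxz y w hyw, ← hM x z' hz' y w hyw, sub_self]
    rwa [sub_eq_zero.1 this]
  -- adjoints are closed
  have hadjclosed : ∀ A B : Submodule ℍᵐᵒᵖ (K × K),
      (∀ x z, (x, z) ∈ B ↔ ∀ y w, (y, w) ∈ A → inn x w = inn z y) →
      IsClosed (B : Set (K × K)) := by
    intro A B hAB
    have hset : (B : Set (K × K)) = ⋂ (y : K) (w : K) (_ : (y, w) ∈ A),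
        {p : K × K | inn w p.1 = inn y p.2} := by
      ext ⟨x, z⟩
      simp only [SetLike.mem_coe, hAB, Set.mem_iInter, Set.mem_ofPred_eq]
      refine forall_congr' fun y => forall_congr' fun w => forall_congr' fun _ => ?_
      rw [h.conj_symm x w, h.conj_symm z y, star_inj]
    rw [hset]
    refine isClosed_iInter fun y => isClosed_iInter fun w => isClosed_iInter fun _ => ?_
    exact isClosed_eq ((h.continuous_right w).comp continuous_fst)
      ((h.continuous_right y).comp continuous_snd)
  have hScl := hadjclosed T S fun x z => ⟨hS x z, hSc x z⟩
  have hMcl := hadjclosed M M fun x z => ⟨hM x z, hMc x z⟩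
  have cT : ∀ y z, (y, z) ∈ C → ∃ a, (y, a) ∈ T ∧ inn a a = inn y z ∧
      ∀ x w, (x, w) ∈ T → inn w a = inn x z := by
    intro y z hyz
    obtain ⟨a, hya, haz⟩ := (hC1 _ _).1 hyz
    have : ∀ x w, (x, w) ∈ T → inn w a = inn x z := fun x w hxw => by
      rw [h.conj_symm w a, hS a z haz x w hxw, ← h.conj_symm]
    exact ⟨a, hya, this y a hya, this⟩
  have cM : ∀ y z, (y, z) ∈ C → ∃ a, (y, a) ∈ M ∧ inn a a = inn y z ∧
      ∀ x w, (x, w) ∈ M → inn w a = inn x z := by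
    intro y z hyz
    obtain ⟨a, hya, haz⟩ := (hC3 _ _).1 hyz
    have : ∀ x w, (x, w) ∈ M → inn w a = inn x z := fun x w hxw => (hM x w hxw a z haz).symm
    exact ⟨a, hya, this y a hya, this⟩
  have cS : ∀ y z, (y, z) ∈ C → ∃ a, (y, a) ∈ S ∧ inn a a = inn y z ∧
      ∀ x w, (x, w) ∈ S → inn w a = inn x z := by
    intro y z hyz
    obtain ⟨a, hya, haz⟩ := (hC2 _ _).1 hyz
    have : ∀ x w, (x, w) ∈ S → inn w a = inn x z := fun x w hxw => (hS x w hxw a z haz).symm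
    exact ⟨a, hya, this y a hya, this⟩
  have weak : ∀ {A : Submodule ℍᵐᵒᵖ (K × K)}, (∀ y z, (y, z) ∈ C → ∃ a, (y, a) ∈ A ∧
      inn a a = inn y z ∧ ∀ x w, (x, w) ∈ A → inn w a = inn x z) →
      ∀ y z, (y, z) ∈ C → ∃ b, (y, b) ∈ A ∧ inn b b = inn y z := by
    intro A hA y z hyz
    obtain ⟨a, h1, h2, -⟩ := hA y z hyz
    exact ⟨a, h1, h2⟩
  have TM := core_compare h T M C hT hMcl hTf hMf hsurj cT (weak cM)
  have MT := core_compare h M T C hMcl hT hMf hTf hsurj cM (weak cT)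
  have TS := core_compare h T S C hT hScl hTf hSf hsurj cT (weak cS)
  have ST := core_compare h S T C hScl hT hSf hTf hsurj cS (weak cT)
  have ker : ∀ {A B : Submodule ℍᵐᵒᵖ (K × K)},
      (∀ x a, (x, a) ∈ A → ∃ b, (x, b) ∈ B ∧ ‖b‖ = ‖a‖) → ∀ x, (x, (0 : K)) ∈ A →
      (x, (0 : K)) ∈ B := by
    intro A B hAB x hx
    obtain ⟨b, hb, hb0⟩ := hAB x 0 hx
    rw [norm_zero, norm_eq_zero] at hb0
    rwa [hb0] at hb
  have huM : ∀ x m m', (x, m) ∈ M → (x, m') ∈ M → m = m' := by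
    intro x m m' h1 h2
    refine sub_eq_zero.1 (hMf _ ?_)
    have := M.sub_mem h1 h2
    rwa [Prod.mk_sub_mk, sub_self] at this
  have hTMn : ∀ x t m, (x, t) ∈ T → (x, m) ∈ M → ‖m‖ = ‖t‖ := by
    intro x t m ht hm
    obtain ⟨b, hb, hbn⟩ := TM x t ht
    rw [huM x m b hm hb, hbn]
  let G : Submodule ℍᵐᵒᵖ (K × K) :=
    { carrier := {p | ∃ x m t n, (x, m) ∈ M ∧ (x, t) ∈ T ∧ (n, (0 : K)) ∈ T ∧
        p = (m + n, t + n)}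
      zero_mem' := ⟨0, 0, 0, 0, M.zero_mem, T.zero_mem, T.zero_mem, by rw [add_zero]; rfl⟩
      add_mem' := by
        rintro _ _ ⟨x, m, t, n, h1, h2, h3, rfl⟩ ⟨x', m', t', n', h1', h2', h3', rfl⟩
        refine ⟨x + x', m + m', t + t', n + n', M.add_mem h1 h1', T.add_mem h2 h2', ?_, ?_⟩
        · have := T.add_mem h3 h3'
          rwa [Prod.mk_add_mk, add_zero] at this
        · rw [Prod.mk_add_mk]; congr 1 <;> abel
      smul_mem' := by
        rintro q _ ⟨x, m, t, n, h1, h2, h3, rfl⟩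
        refine ⟨q • x, q • m, q • t, q • n, M.smul_mem q h1, T.smul_mem q h2, ?_, ?_⟩
        · have := T.smul_mem q h3
          rwa [Prod.smul_mk, smul_zero] at this
        · rw [Prod.smul_mk, smul_add, smul_add] }
  have hGmk : ∀ x m t, (x, m) ∈ M → (x, t) ∈ T → (m, t) ∈ G := fun x m t hm ht =>
    ⟨x, m, t, 0, hm, ht, T.zero_mem, by simp⟩
  have hGker : ∀ n, (n, (0 : K)) ∈ T → (n, n) ∈ G := fun n hn =>
    ⟨0, 0, 0, n, M.zero_mem, T.zero_mem, hn, by simp⟩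
  obtain ⟨W, Ws, hadj, h1, h2, hWG⟩ := exists_unitary h G (by
    rintro a b ⟨x, m, t, n, hm, ht, hn, hab⟩
    obtain ⟨rfl, rfl⟩ := Prod.mk.inj hab
    have e1 : inn n m = 0 := by
      rw [hM n 0 (ker TM n hn) x m hm, h.zero_left]
    have e2 : inn n t = 0 := by
      rw [hS n 0 (ker TS n hn) x t ht, h.zero_left]
    refine (sq_eq_sq₀ (norm_nonneg _) (norm_nonneg _)).1 ?_
    rw [h.norm_add_sq, h.norm_add_sq, h.eq_zero_symm e1, h.eq_zero_symm e2,
      hTMn x t m ht hm])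
    (by
      intro z hz
      have hzM : (z, (0 : K)) ∈ M := hMc _ _ fun y w hyw => by
        obtain ⟨t, ht, -⟩ := MT y w hyw
        rw [hz w t (hGmk y w t hyw ht), h.zero_left]
      exact h.eq_zero_of_self (hz z z (hGker z (ker MT z hzM))))
    (by
      intro z hz
      have hzS : (z, (0 : K)) ∈ S := hSc _ _ fun y w hyw => by
        obtain ⟨m, hm, -⟩ := TM y w hyw
        rw [hz m w (hGmk y m w hm hyw), h.zero_left]
      exact h.eq_zero_of_self (hz z z (hGker z (ker ST z hzS))))
  refine ⟨W, Ws, hadj, h1, h2, fun x => ⟨?_, ?_⟩, fun x t m ht hm => hWG _ _ (hGmk x m t hm ht)⟩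
  · rintro ⟨t, ht⟩
    obtain ⟨m, hm, -⟩ := TM x t ht
    exact ⟨m, hm⟩
  · rintro ⟨m, hm⟩
    obtain ⟨t, ht, -⟩ := MT x m hm
    exact ⟨t, ht⟩

theorem mem_graph_iff' (T : K →ₗ.[ℍᵐᵒᵖ] K) (x y : K) :
    (x, y) ∈ T.graph ↔ ∃ hx : x ∈ T.domain, T ⟨x, hx⟩ = y := by
  rw [LinearPMap.mem_graph_iff]
  constructor
  · rintro ⟨⟨x', hx'⟩, rfl, rfl⟩
    exact ⟨hx', rfl⟩
  · rintro ⟨hx, rfl⟩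
    exact ⟨⟨x, hx⟩, rfl, rfl⟩

theorem isCompP_graph {S T C : K →ₗ.[ℍᵐᵒᵖ] K} (h : IsCompP S T C) (x z : K) :
    (x, z) ∈ C.graph ↔ ∃ w, (x, w) ∈ T.graph ∧ (w, z) ∈ S.graph := by
  simp only [mem_graph_iff']
  constructor
  · rintro ⟨hx, rfl⟩
    obtain ⟨hT, hS⟩ := (h.1 x).1 hx
    exact ⟨_, ⟨hT, rfl⟩, hS, (h.2 ⟨x, hx⟩ hT hS).symm⟩
  · rintro ⟨_, ⟨hT, rfl⟩, hS, rfl⟩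
    exact ⟨(h.1 x).2 ⟨hT, hS⟩, h.2 ⟨x, _⟩ hT hS⟩

theorem isAdjP_graph {inn : K → K → ℍ} {T S : K →ₗ.[ℍᵐᵒᵖ] K} (h : IsAdjP inn T S) :
    (∀ x z, (x, z) ∈ S.graph → ∀ y w, (y, w) ∈ T.graph → inn x w = inn z y) ∧
    (∀ x z, (∀ y w, (y, w) ∈ T.graph → inn x w = inn z y) → ∃ z', (x, z') ∈ S.graph) := by
  simp only [mem_graph_iff']
  constructor
  · rintro x _ ⟨hx, rfl⟩ y _ ⟨hy, rfl⟩
    exact h.1 ⟨x, hx⟩ ⟨y, hy⟩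
  · intro x z hxz
    exact ⟨_, h.2 x z fun y => hxz y _ ⟨y.2, rfl⟩, rfl⟩

end Helpers

/-- if `T` is densely defined, closed and normal, then there is a unitary
operator `W` with `T = W |T|`. -/
theorem polar_decomposition_normal_unitary
    [CompleteSpace H] (inn : H → H → ℍ) (hinn : QInner inn)
    (T Ts TsT TTs modT : H →ₗ.[ℍᵐᵒᵖ] H)
    (hdense : Dense (T.domain : Set H))
    (hclosed : IsClosed (T.graph : Set (H × H)))
    (hadj : IsAdjP inn T Ts)
    (hcomp : IsCompP Ts T TsT) (hcomp' : IsCompP T Ts TTs)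
    (hnormal : TsT = TTs)
    (hmodpos : IsPosP inn modT) (hmodsq : IsCompP modT modT TsT) :
    ∃ W Ws : H →L[ℍᵐᵒᵖ] H,
      IsAdjB inn W Ws ∧ Ws.comp W = 1 ∧ W.comp Ws = 1 ∧ EqCompB T W modT := by
  obtain ⟨hS, hS'⟩ := isAdjP_graph hadj
  obtain ⟨hM, hM'⟩ := isAdjP_graph hmodpos.1
  subst hnormal
  have hf : ∀ (A : H →ₗ.[ℍᵐᵒᵖ] H) (a : H), (0, a) ∈ A.graph → a = 0 := fun A a ha =>
    A.graph_fst_eq_zero_snd ha rfl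
  obtain ⟨W, Ws, h1, h2, h3, h4, h5⟩ := polar_rel hinn T.graph Ts.graph TsT.graph modT.graph
    hclosed (by
      intro z hz
      have hcl : IsClosed {x : H | inn z x = 0} :=
        isClosed_eq (hinn.continuous_right z) continuous_const
      have hsub : (T.domain : Set H) ⊆ {x : H | inn z x = 0} := fun x hx =>
        hz x _ ((mem_graph_iff' T x _).2 ⟨hx, rfl⟩)
      exact hinn.eq_zero_of_self (closure_minimal hsub hcl (hdense z)))
    (hf T) (hf Ts) (hf modT) hS hS' hM hM' (isCompP_graph hcomp) (isCompP_graph hcomp')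
    (isCompP_graph hmodsq)
  refine ⟨W, Ws, h1, h2, h3, ?_, fun x hx hx' => ?_⟩
  · ext x
    have := h4 x
    simp only [mem_graph_iff'] at this
    constructor
    · intro hx
      obtain ⟨_, hm, -⟩ := this.1 ⟨_, hx, rfl⟩
      exact hm
    · intro hx
      obtain ⟨_, hm, -⟩ := this.2 ⟨_, hx, rfl⟩
      exact hm
  · exact (h5 x _ _ ((mem_graph_iff' T x _).2 ⟨hx, rfl⟩)
      ((mem_graph_iff' modT x _).2 ⟨hx', rfl⟩)).symm
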